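/- Let 1<p<q<∞ and w∈A_{p,q}, and let b∈BMO(ℝⁿ). Then there is a constant C such that for every ball B⊆ℝⁿ, (∫_B |b(y)−b_B|^{p′} w(y)^{−p′}dy)^{1/p′} ≤ C‖b‖_*·|B|^{1/q+1/p′}·w^q(B)^{−1/q}, where p′=p/(p−1). -/

import Mathlib

open MeasureTheory Metric Set
open scoped ENNReal NNReal

noncomputable section

/-- Euclidean space ℝⁿ. -/
abbrev Rn (n : ℕ) := EuclideanSpace ℝ (Fin n)

variable {n : ℕ}

/-- A weight: a nonnegative locally integrable function on ℝⁿ. -/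
def IsWeight (w : Rn n → ℝ) : Prop :=
  (∀ x, 0 ≤ w x) ∧ LocallyIntegrable w volume

/-- Weighted measure of a set: `v(E) = ∫_E v`. -/
def wMeas (v : Rn n → ℝ) (E : Set (Rn n)) : ℝ≥0∞ :=
  ∫⁻ x in E, ENNReal.ofReal (v x)

/-- Average of `b` over a set: `b_E = |E|⁻¹ ∫_E b`. -/
def avg (b : Rn n → ℝ) (E : Set (Rn n)) : ℝ :=
  ⨍ y in E, b y

/-- BMO seminorm ‖b‖_*. -/
def bmoNorm (b : Rn n → ℝ) : ℝ≥0∞ :=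
  ⨆ (x : Rn n) (r : ℝ) (_ : 0 < r),
    (volume (ball x r))⁻¹ *
      ∫⁻ y in ball x r, ENNReal.ofReal |b y - avg b (ball x r)|

/-- `b ∈ BMO(ℝⁿ)`. -/
def IsBMO (b : Rn n → ℝ) : Prop :=
  LocallyIntegrable b volume ∧ bmoNorm b ≠ ∞

/-- Homogeneous Lipschitz seminorm of order β. -/
def lipNorm (β : ℝ) (b : Rn n → ℝ) : ℝ≥0∞ :=
  ⨆ (x : Rn n) (h : Rn n) (_ : h ≠ 0),
    ENNReal.ofReal (|b (x + h) - b x| / ‖h‖ ^ β)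

/-- Two-weight weighted Morrey norm ‖f‖_{L^{p,κ}(u,v)}. -/
def morreyNorm (p κ : ℝ) (u v : Rn n → ℝ) (f : Rn n → ℝ) : ℝ≥0∞ :=
  ⨆ (x : Rn n) (r : ℝ) (_ : 0 < r),
    ((wMeas v (ball x r)) ^ (-κ) *
      (∫⁻ y in ball x r, ENNReal.ofReal |f y| ^ p * ENNReal.ofReal (u y))) ^ (1 / p)

/-- Weighted weak Morrey norm ‖f‖_{WL^{p,κ}(v)}. -/
def weakMorreyNorm (p κ : ℝ) (v : Rn n → ℝ) (f : Rn n → ℝ) : ℝ≥0∞ :=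
  ⨆ (x : Rn n) (r : ℝ) (_ : 0 < r) (t : ℝ) (_ : 0 < t),
    (wMeas v (ball x r)) ^ (-(κ / p)) * ENNReal.ofReal t *
      (wMeas v {y ∈ ball x r | t < |f y|}) ^ (1 / p)

/-- Weighted Lᵖ norm ‖f‖_{L^p(v)}. -/
def wLpNorm (p : ℝ) (v : Rn n → ℝ) (f : Rn n → ℝ) : ℝ≥0∞ :=
  (∫⁻ x, ENNReal.ofReal |f x| ^ p * ENNReal.ofReal (v x)) ^ (1 / p)

/-- Muckenhoupt class A_{p,q} for 1 < p ≤ q < ∞. -/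
def IsApq (p q : ℝ) (w : Rn n → ℝ) : Prop :=
  ∃ C : ℝ≥0, ∀ (x : Rn n) (r : ℝ), 0 < r →
    ((volume (ball x r))⁻¹ * (∫⁻ y in ball x r, ENNReal.ofReal (w y) ^ q)) ^ (1 / q) *
      ((volume (ball x r))⁻¹ *
        (∫⁻ y in ball x r, ENNReal.ofReal (w y) ^ (-(p / (p - 1))))) ^ (1 - 1 / p) ≤ C

/-- Muckenhoupt class A_{1,q} for 1 < q < ∞. -/
def IsA1q (q : ℝ) (w : Rn n → ℝ) : Prop :=
  ∃ C : ℝ≥0, ∀ (x : Rn n) (r : ℝ), 0 < r →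
    ((volume (ball x r))⁻¹ * (∫⁻ y in ball x r, ENNReal.ofReal (w y) ^ q)) ^ (1 / q) ≤
      C * essInf (fun y => ENNReal.ofReal (w y)) (volume.restrict (ball x r))

/-- Muckenhoupt class A_p for 1 < p < ∞. -/
def IsAp (p : ℝ) (w : Rn n → ℝ) : Prop :=
  ∃ C : ℝ≥0, ∀ (x : Rn n) (r : ℝ), 0 < r →
    ((volume (ball x r))⁻¹ * (∫⁻ y in ball x r, ENNReal.ofReal (w y))) *
      ((volume (ball x r))⁻¹ *
        (∫⁻ y in ball x r, ENNReal.ofReal (w y) ^ (-(1 / (p - 1))))) ^ (p - 1) ≤ C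

/-- Muckenhoupt class A_1. -/
def IsA1 (w : Rn n → ℝ) : Prop :=
  ∃ C : ℝ≥0, ∀ (x : Rn n) (r : ℝ), 0 < r →
    (volume (ball x r))⁻¹ * (∫⁻ y in ball x r, ENNReal.ofReal (w y)) ≤
      C * essInf (fun y => ENNReal.ofReal (w y)) (volume.restrict (ball x r))

/-- Reverse Hölder class RH_r. -/
def IsRH (r : ℝ) (w : Rn n → ℝ) : Prop :=
  ∃ C : ℝ≥0, 0 < C ∧ ∀ (x : Rn n) (ρ : ℝ), 0 < ρ →
    ((volume (ball x ρ))⁻¹ * (∫⁻ y in ball x ρ, ENNReal.ofReal (w y) ^ r)) ^ (1 / r) ≤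
      C * ((volume (ball x ρ))⁻¹ * (∫⁻ y in ball x ρ, ENNReal.ofReal (w y)))

/-- The integral operator `Tf(x) = ∫ K(x,y) f(y) dy`. -/
def intOp (K : Rn n → Rn n → ℝ) (f : Rn n → ℝ) (x : Rn n) : ℝ :=
  ∫ y, K x y * f y

/-- The commutator `[b,T]f(x) = b(x)Tf(x) - T(bf)(x)`. -/
def commOp (b : Rn n → ℝ) (K : Rn n → Rn n → ℝ) (f : Rn n → ℝ) (x : Rn n) : ℝ :=
  b x * intOp K f x - intOp K (fun y => b y * f y) x

lemma volume_ball_mul (x : Rn n) {c : ℝ} (hc : 0 < c) (r : ℝ) :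
    volume (ball x (c * r)) = ENNReal.ofReal (c ^ n) * volume (ball x r) := by
  rw [Measure.addHaar_ball_mul_of_pos volume x hc, finrank_euclideanSpace_fin,
    Measure.addHaar_ball_center volume x]

/-- A small ball centred in a larger ball meets it in a fixed proportion of its volume. -/
lemma volume_ball_le_inter {x x₀ : Rn n} {ρ R : ℝ} (hx : x ∈ ball x₀ R) (hρ : 0 < ρ)
    (hρR : ρ ≤ R) :
    volume (ball x ρ) ≤ 2 ^ n * volume (ball x ρ ∩ ball x₀ R) := by
  have hR : 0 < R := hρ.trans_le hρR
  rw [mem_ball, dist_eq_norm] at hx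
  have hsub : ball (x + (ρ / (2 * R)) • (x₀ - x)) (ρ / 2) ⊆ ball x ρ ∩ ball x₀ R := by
    have hc : 0 ≤ ρ / (2 * R) := by positivity
    have hc1 : ρ / (2 * R) ≤ 1 := by rw [div_le_one (by positivity)]; linarith
    have h1 : ρ / (2 * R) * R = ρ / 2 := by field_simp
    refine subset_inter (ball_subset_ball' ?_) (ball_subset_ball' ?_)
    · rw [dist_eq_norm, add_sub_cancel_left, norm_smul, Real.norm_of_nonneg hc, norm_sub_rev]
      nlinarith
    · have : x + (ρ / (2 * R)) • (x₀ - x) - x₀ = (1 - ρ / (2 * R)) • (x - x₀) := by module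
      rw [dist_eq_norm, this, norm_smul, Real.norm_of_nonneg (by linarith)]
      nlinarith
  calc volume (ball x ρ) = volume (ball x (2 * (ρ / 2))) := by ring_nf
    _ = 2 ^ n * volume (ball x (ρ / 2)) := by
      rw [volume_ball_mul x two_pos, ENNReal.ofReal_pow zero_le_two]; simp
    _ = 2 ^ n * volume (ball (x + (ρ / (2 * R)) • (x₀ - x)) (ρ / 2)) := by
      rw [Measure.addHaar_ball_center, Measure.addHaar_ball_center volume (x + _)]
    _ ≤ _ := by gcongr

lemma ae_eventually_volume_ball_lt {E : Set (Rn n)} (hE : MeasurableSet E) :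
    ∀ᵐ x, x ∈ E → ∀ᶠ r in nhdsWithin (0 : ℝ) (Ioi 0),
      volume (ball x r) < 2 * volume (E ∩ ball x r) := by
  filter_upwards [Besicovitch.ae_tendsto_measure_inter_div_of_measurableSet volume hE]
    with x hx hxE
  rw [indicator_of_mem hxE, Pi.one_apply] at hx
  filter_upwards [hx.eventually (lt_mem_nhds (a := 2⁻¹) (by simp)), self_mem_nhdsWithin]
    with r hr hr0
  have hr0' : 0 < r := hr0
  have hae : (ball x r : Set (Rn n)) =ᵐ[volume] closedBall x r := by
    rw [← ball_union_sphere]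
    exact (union_ae_eq_left_of_ae_eq_empty (ae_eq_empty.2
      (Measure.addHaar_sphere_of_ne_zero volume x hr0'.ne'))).symm
  rw [measure_congr hae, measure_congr ((ae_eq_refl E).inter hae)]
  have h0 : volume (closedBall x r) ≠ 0 := (measure_closedBall_pos volume x hr0').ne'
  have ht : volume (closedBall x r) ≠ ∞ := measure_closedBall_lt_top.ne
  rw [ENNReal.lt_div_iff_mul_lt (Or.inl h0) (Or.inl ht), mul_comm, ← div_eq_mul_inv] at hr
  rwa [ENNReal.div_lt_iff (Or.inl two_ne_zero) (Or.inl ENNReal.ofNat_ne_top), mul_comm] at hr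

/-- A set of small relative volume in a ball has, around almost every point, a ball in which its
density is comparable to a prescribed threshold. -/
lemma ae_exists_stopping_radius {E : Set (Rn n)} (hE : MeasurableSet E) {x₀ : Rn n} {R : ℝ}
    (hR : 0 < R) {H : ℝ≥0∞} (hH : 2 ≤ H)
    (hsmall : H * volume E ≤ volume (ball x₀ R)) :
    ∀ᵐ x, x ∈ E → ∃ ρ, 0 < ρ ∧ ρ ≤ R ∧ volume (ball x ρ) < H * volume (E ∩ ball x ρ) ∧
      H * volume (E ∩ ball x ρ) ≤ 2 ^ n * volume (ball x ρ) := by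
  classical
  filter_upwards [ae_eventually_volume_ball_lt hE] with x hx hxE
  have htend : Filter.Tendsto (fun j : ℕ => 2 * R * (1 / 2) ^ j) Filter.atTop
      (nhdsWithin (0 : ℝ) (Ioi 0)) := by
    refine tendsto_nhdsWithin_iff.2 ⟨?_, Filter.Eventually.of_forall fun j => ?_⟩
    · simpa using (tendsto_pow_atTop_nhds_zero_of_lt_one (r := (1 / 2 : ℝ)) (by norm_num)
        (by norm_num)).const_mul (2 * R)
    · simp only [mem_Ioi]; positivity
  have hex : ∃ j : ℕ, volume (ball x (2 * R * (1 / 2) ^ j)) <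
      H * volume (E ∩ ball x (2 * R * (1 / 2) ^ j)) := by
    obtain ⟨j, hj⟩ := (htend.eventually (hx hxE)).exists
    exact ⟨j, hj.trans_le (by gcongr)⟩
  obtain ⟨i, hi⟩ : ∃ i, Nat.find hex = i + 1 := by
    refine Nat.exists_eq_succ_of_ne_zero fun h0 => ?_
    have := Nat.find_spec hex
    rw [h0] at this
    refine this.not_ge ?_
    calc _ ≤ H * volume E := by gcongr; exact inter_subset_left
      _ ≤ volume (ball x₀ R) := hsmall
      _ = volume (ball x R) := by
        rw [Measure.addHaar_ball_center, Measure.addHaar_ball_center volume x]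
      _ ≤ _ := measure_mono (ball_subset_ball (by simp; linarith))
  have hspec := Nat.find_spec hex
  have hmin := Nat.find_min hex (m := i) (by omega)
  rw [hi] at hspec
  have hdbl : 2 * R * (1 / 2) ^ i = 2 * (2 * R * (1 / 2) ^ (i + 1)) := by rw [pow_succ]; ring
  refine ⟨_, by positivity, ?_, hspec, ?_⟩
  · have : ((1 : ℝ) / 2) ^ i ≤ 1 := pow_le_one₀ (by norm_num) (by norm_num)
    rw [pow_succ]; nlinarith
  · calc _ ≤ H * volume (E ∩ ball x (2 * R * (1 / 2) ^ i)) := by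
          gcongr H * volume (E ∩ ball x ?_)
          rw [hdbl]
          have : 0 < 2 * R * (1 / 2) ^ (i + 1) := by positivity
          linarith
      _ ≤ _ := not_lt.1 hmin
      _ = _ := by rw [hdbl, volume_ball_mul x two_pos, ENNReal.ofReal_pow zero_le_two]; simp

lemma mul_volume_deviation_le {b : Rn n → ℝ} (hb : Measurable b) {x : Rn n} {r c : ℝ} {N H : ℝ≥0}
    (hN : 0 < N) (hc : ∫⁻ y in ball x r, ENNReal.ofReal |b y - c| ≤ N * volume (ball x r)) :
    H * volume (ball x r ∩ {y | H * N ≤ |b y - c|}) ≤ volume (ball x r) := by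
  have hm : Measurable fun y => ENNReal.ofReal |b y - c| := by fun_prop
  have h := (mul_meas_ge_le_lintegral (μ := volume.restrict (ball x r)) hm
    (H * N : ℝ≥0)).trans hc
  have hset : {y | ((H * N : ℝ≥0) : ℝ≥0∞) ≤ ENNReal.ofReal |b y - c|} =
      {y | H * N ≤ |b y - c|} := by
    ext y
    simp only [mem_ofPred_eq]
    rw [← ENNReal.ofReal_coe_nnreal, ENNReal.ofReal_le_ofReal_iff (abs_nonneg _), NNReal.coe_mul]
  rw [Measure.restrict_apply (measurableSet_le measurable_const hm), hset, inter_comm,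
    ENNReal.coe_mul, mul_comm (H : ℝ≥0∞), mul_assoc] at h
  exact (ENNReal.mul_le_mul_iff_right (by simpa using hN.ne') ENNReal.coe_ne_top).1 h

/-- The part of the ball `B(x₀, R)` where `b` deviates from `c` by at least `t`. -/
def levelSet (b : Rn n → ℝ) (x₀ : Rn n) (R c t : ℝ) : Set (Rn n) :=
  ball x₀ R ∩ {y | t ≤ |b y - c|}

lemma measurableSet_levelSet {b : Rn n → ℝ} (hb : Measurable b) (x₀ : Rn n) (R c t : ℝ) :
    MeasurableSet (levelSet b x₀ R c t) :=
  measurableSet_ball.inter (measurableSet_le measurable_const (by fun_prop))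

lemma levelSet_anti (b : Rn n → ℝ) (x₀ : Rn n) (R c : ℝ) : Antitone (levelSet b x₀ R c) :=
  fun _ _ hst _ hy => ⟨hy.1, hst.trans hy.2⟩

/-- Around almost every point of a level set there is a ball, a fixed proportion of which lies
between two consecutive level sets. -/
lemma ae_exists_ball_between_levelSets {b : Rn n → ℝ} (hb : Measurable b) {N : ℝ≥0} (hN : 0 < N)
    {a : Rn n → ℝ → ℝ} (hosc : ∀ x r, 0 < r →
      ∫⁻ y in ball x r, ENNReal.ofReal |b y - a x r| ≤ N * volume (ball x r))
    {x₀ : Rn n} {R t : ℝ} (hR : 0 < R) (ht : 4 * 4 ^ n * N ≤ t) :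
    ∀ᵐ x, x ∈ levelSet b x₀ R (a x₀ R) t → ∃ ρ, 0 < ρ ∧ ρ ≤ R ∧
      volume (ball x ρ) ≤ 2 * 2 ^ n * volume (ball x ρ ∩
        (levelSet b x₀ R (a x₀ R) (t - 2 * (4 * 4 ^ n * N)) \ levelSet b x₀ R (a x₀ R) t)) := by
  set c := a x₀ R
  set H : ℝ≥0 := 4 * 4 ^ n with hH
  have hHr : (4 * 4 ^ n : ℝ) = H := by simp [hH]
  have hH2 : (2 : ℝ≥0) ≤ H := by
    have : (1 : ℝ≥0) ≤ 4 ^ n := one_le_pow₀ (by norm_num)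
    calc (2 : ℝ≥0) ≤ 4 * 1 := by norm_num
      _ ≤ H := by rw [hH]; gcongr
  rw [hHr] at ht ⊢
  have hsmall : H * volume (levelSet b x₀ R c t) ≤ volume (ball x₀ R) :=
    le_trans (by gcongr; exact levelSet_anti b x₀ R c ht)
      (mul_volume_deviation_le hb hN (hosc x₀ R hR))
  filter_upwards [ae_exists_stopping_radius (measurableSet_levelSet hb x₀ R c t) hR
    (H := H) (by exact_mod_cast hH2) hsmall] with x hx hxE
  obtain ⟨ρ, hρ, hρR, hlow, hupp⟩ := hx hxE
  refine ⟨ρ, hρ, hρR, ?_⟩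
  set E := levelSet b x₀ R c t
  set E' := levelSet b x₀ R c (t - 2 * (H * N))
  set B := ball x ρ
  set D := B ∩ {y | H * N ≤ |b y - a x ρ|}
  have hD : H * volume D ≤ volume B := mul_volume_deviation_le hb hN (hosc x ρ hρ)
  obtain ⟨y, ⟨hyE, hyB⟩, hyD⟩ : ∃ y ∈ E ∩ B, y ∉ D := by
    by_contra! hcon
    exact hlow.not_ge (le_trans (by gcongr; exact hcon) hD)
  have hy1 : |b y - a x ρ| < H * N := by
    by_contra! hcon
    exact hyD ⟨hyB, hcon⟩
  have hcover : B ∩ ball x₀ R ⊆ B ∩ (E' \ E) ∪ (E ∩ B) ∪ D := by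
    rintro z ⟨hzB, hz0⟩
    by_cases hzE : z ∈ E
    · exact Or.inl (Or.inr ⟨hzE, hzB⟩)
    by_cases hzD : z ∈ D
    · exact Or.inr hzD
    have hz1 : |b z - a x ρ| < H * N := by
      by_contra! hcon
      exact hzD ⟨hzB, hcon⟩
    refine Or.inl (Or.inl ⟨hzB, ⟨hz0, ?_⟩, hzE⟩)
    have h1 : t ≤ |b y - c| := hyE.2
    have h2 : |b y - c| ≤ |b y - a x ρ| + |b z - a x ρ| + |b z - c| := by
      have := abs_add_three (b y - a x ρ) (a x ρ - b z) (b z - c)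
      rwa [abs_sub_comm (a x ρ), show b y - a x ρ + (a x ρ - b z) + (b z - c) = b y - c by ring]
        at this
    change t - 2 * (H * N) ≤ |b z - c|
    linarith
  have hvol := (volume_ball_le_inter (hxE.1) hρ hρR).trans
    (mul_le_mul_right ((measure_mono hcover).trans ((measure_union_le _ _).trans
      (add_le_add_left (measure_union_le _ _) _))) _)
  have hfin : volume B ≠ ∞ := measure_ball_lt_top.ne
  have f1 : volume (B ∩ (E' \ E)) ≠ ∞ := measure_ne_top_of_subset inter_subset_left hfin
  have f2 : volume (E ∩ B) ≠ ∞ := measure_ne_top_of_subset inter_subset_right hfin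
  have f3 : volume D ≠ ∞ := measure_ne_top_of_subset inter_subset_left hfin
  change volume B ≤ _ at hvol
  generalize volume (B ∩ (E' \ E)) = g at *
  generalize volume (E ∩ B) = e at *
  generalize volume D = d at *
  generalize volume B = v at *
  lift g to ℝ≥0 using f1
  lift e to ℝ≥0 using f2
  lift d to ℝ≥0 using f3
  lift v to ℝ≥0 using hfin
  norm_cast at hvol hD hupp ⊢
  rw [← NNReal.coe_le_coe] at hvol hD hupp ⊢
  rw [hH] at hD hupp
  push_cast at hvol hD hupp ⊢
  have h4 : (4 : ℝ) ^ n = 2 ^ n * 2 ^ n := by rw [← mul_pow]; norm_num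
  rw [h4] at hD hupp
  have hm : (1 : ℝ) ≤ 2 ^ n := one_le_pow₀ (by norm_num)
  generalize (2 : ℝ) ^ n = m at *
  have he : 4 * (m * e) ≤ v := by
    refine le_of_mul_le_mul_left ?_ (zero_lt_one.trans_le hm)
    linarith
  have hd : 4 * (m * d) ≤ v := by
    refine le_trans ?_ hD
    have : m * d ≤ m * (m * d) := le_mul_of_one_le_left (by positivity) hm
    linarith
  linarith

/-- A quantitative form of the Muckenhoupt condition `A_∞` for a measure, incorporating doubling. -/
def IsBallControlled (σ : Measure (Rn n)) (K : ℝ≥0) : Prop :=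
  ∀ (x : Rn n) (r : ℝ), 0 < r → ∀ G ⊆ ball x r, MeasurableSet G →
    volume (ball x r) ≤ 2 * 2 ^ n * volume G → σ (ball x (6 * r)) ≤ K * σ G

lemma IsBallControlled.measure_levelSet_le {σ : Measure (Rn n)} {K : ℝ≥0}
    (hK : IsBallControlled σ K) (hσ : σ ≪ volume)
    {b : Rn n → ℝ} (hb : Measurable b) {N : ℝ≥0} (hN : 0 < N)
    {a : Rn n → ℝ → ℝ} (hosc : ∀ x r, 0 < r →
      ∫⁻ y in ball x r, ENNReal.ofReal |b y - a x r| ≤ N * volume (ball x r))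
    {x₀ : Rn n} {R t : ℝ} (hR : 0 < R) (ht : 4 * 4 ^ n * N ≤ t) :
    (1 + K) * σ (levelSet b x₀ R (a x₀ R) t) ≤
      K * σ (levelSet b x₀ R (a x₀ R) (t - 2 * (4 * 4 ^ n * N))) := by
  set c := a x₀ R
  set E := levelSet b x₀ R c t
  set E' := levelSet b x₀ R c (t - 2 * (4 * 4 ^ n * N)) with hE'
  have hE : MeasurableSet E := measurableSet_levelSet hb x₀ R c t
  have hEE' : E ⊆ E' := levelSet_anti b x₀ R c (by
    have : (0 : ℝ) ≤ 2 * (4 * 4 ^ n * N) := by positivity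
    linarith)
  have hdiff : MeasurableSet (E' \ E) := (measurableSet_levelSet hb x₀ R c _).diff hE
  have hae := ae_exists_ball_between_levelSets hb hN hosc (x₀ := x₀) hR ht
  set T := {x | x ∈ E ∧ ∃ ρ, 0 < ρ ∧ ρ ≤ R ∧
    volume (ball x ρ) ≤ 2 * 2 ^ n * volume (ball x ρ ∩ (E' \ E))}
  have hρ : ∀ x, ∃ ρ, x ∈ T → 0 < ρ ∧ ρ ≤ R ∧
      volume (ball x ρ) ≤ 2 * 2 ^ n * volume (ball x ρ ∩ (E' \ E)) := fun x => by
    by_cases hx : x ∈ T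
    · obtain ⟨ρ, h⟩ := hx.2
      exact ⟨ρ, fun _ => h⟩
    · exact ⟨0, fun h => absurd h hx⟩
  choose ρ hρ using hρ
  obtain ⟨u, huT, hdisj, hcov⟩ := Vitali.exists_disjoint_subfamily_covering_enlargement_closedBall
    T id ρ R (fun x hx => (hρ x hx).2.1) 5 (by norm_num)
  have hdisj' : u.PairwiseDisjoint fun x => ball x (ρ x) :=
    hdisj.mono fun x => ball_subset_closedBall
  have hcount : u.Countable := hdisj'.countable_of_isOpen (fun _ _ => isOpen_ball)
    fun x hx => ⟨x, mem_ball_self (hρ x (huT hx)).1⟩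
  have hsub : T ⊆ ⋃ x ∈ u, ball x (6 * ρ x) := fun x hx => by
    obtain ⟨y, hyu, hy⟩ := hcov x hx
    refine mem_biUnion hyu ?_
    have hpos := (hρ y (huT hyu)).1
    exact closedBall_subset_ball (by linarith) (hy (mem_closedBall_self (hρ x hx).1.le))
  have hET : σ E ≤ σ T := by
    refine measure_mono_ae ?_
    filter_upwards [hσ.ae_le hae] with x hx hxE
    exact ⟨hxE, hx hxE⟩
  have hmain : σ E ≤ K * σ (E' \ E) := calc
    σ E ≤ σ (⋃ x ∈ u, ball x (6 * ρ x)) := hET.trans (measure_mono hsub)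
    _ ≤ ∑' x : u, σ (ball (x : Rn n) (6 * ρ x)) := measure_biUnion_le σ hcount _
    _ ≤ ∑' x : u, K * σ (ball (x : Rn n) (ρ x) ∩ (E' \ E)) := by
      refine ENNReal.tsum_le_tsum fun x => ?_
      have h := hρ x (huT x.2)
      exact hK _ _ h.1 _ inter_subset_left (measurableSet_ball.inter hdiff) h.2.2
    _ = K * σ (⋃ x ∈ u, ball x (ρ x) ∩ (E' \ E)) := by
      rw [ENNReal.tsum_mul_left, measure_biUnion hcount
        (hdisj'.mono fun x => inter_subset_left) fun _ _ => measurableSet_ball.inter hdiff]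
    _ ≤ K * σ (E' \ E) := by
      gcongr
      exact iUnion₂_subset fun _ _ => inter_subset_right
  calc (1 + K) * σ E = K * σ E + σ E := by ring
    _ ≤ K * σ E + K * σ (E' \ E) := by gcongr
    _ = K * σ E' := by rw [← mul_add, ← measure_union disjoint_sdiff_right hdiff,
        union_sdiff_cancel hEE']

lemma tsum_mul_geometric_ne_top {s A : ℝ} (hs : 0 ≤ s) (hA : 0 ≤ A) {γ : ℝ≥0} (hγ : γ < 1) :
    ∑' k : ℕ, ENNReal.ofReal ((k + 1) * A) ^ s * (γ : ℝ≥0∞) ^ k ≠ ∞ := by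
  set m := ⌈s⌉₊
  set δ : ℝ := max γ (1 / 2)
  have hδ0 : 0 < δ := lt_max_of_lt_right (by norm_num)
  have hδ1 : δ < 1 := max_lt (by exact_mod_cast hγ) (by norm_num)
  have hsum : Summable fun k : ℕ => A ^ s * (δ⁻¹ * (((k + 1 : ℕ) : ℝ) ^ m * δ ^ (k + 1))) :=
    (((summable_nat_add_iff 1).2 (summable_pow_mul_geometric_of_norm_lt_one (R := ℝ) m
      (by rwa [Real.norm_of_nonneg hδ0.le]))).mul_left _).mul_left _
  refine ne_top_of_le_ne_top hsum.tsum_ofReal_ne_top (ENNReal.tsum_le_tsum fun k => ?_)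
  rw [ENNReal.ofReal_rpow_of_nonneg (by positivity) hs, ← ENNReal.ofReal_coe_nnreal,
    ← ENNReal.ofReal_pow γ.coe_nonneg, ← ENNReal.ofReal_mul (by positivity)]
  refine ENNReal.ofReal_le_ofReal ?_
  have h1 : ((k : ℝ) + 1) ^ s ≤ ((k : ℝ) + 1) ^ m := by
    rw [← Real.rpow_natCast]
    exact Real.rpow_le_rpow_of_exponent_le (by simp) (Nat.le_ceil s)
  have h2 : (γ : ℝ) ^ k ≤ δ ^ k := by gcongr; exact le_max_left _ _
  calc (((k : ℝ) + 1) * A) ^ s * (γ : ℝ) ^ k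
      = A ^ s * (((k : ℝ) + 1) ^ s * (γ : ℝ) ^ k) := by
        rw [Real.mul_rpow (by positivity) hA]; ring
    _ ≤ A ^ s * (((k : ℝ) + 1) ^ m * δ ^ k) := by gcongr
    _ = _ := by rw [pow_succ δ]; push_cast; field_simp

/-- Weighted John–Nirenberg inequality in `L^s`. -/
lemma IsBallControlled.lintegral_deviation_rpow_le {σ : Measure (Rn n)} {K : ℝ≥0}
    (hK : IsBallControlled σ K) (hσ : σ ≪ volume) {s : ℝ} (hs : 0 < s) :
    ∃ C : ℝ≥0, ∀ (b : Rn n → ℝ) (_ : Measurable b) (N : ℝ≥0) (_ : 0 < N) (a : Rn n → ℝ → ℝ)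
      (_ : ∀ x r, 0 < r →
        ∫⁻ y in ball x r, ENNReal.ofReal |b y - a x r| ≤ N * volume (ball x r))
      (x₀ : Rn n) (R : ℝ), 0 < R →
      ∫⁻ y in ball x₀ R, ENNReal.ofReal |b y - a x₀ R| ^ s ∂σ ≤
        C * (N : ℝ≥0∞) ^ s * σ (ball x₀ R) := by
  set γ : ℝ≥0 := K / (1 + K) with hγdef
  have hγ : γ < 1 := (div_lt_one (by positivity)).2 (by simp)
  set A : ℝ := 2 * (4 * 4 ^ n)
  have hA : 0 < A := by positivity
  have hS := tsum_mul_geometric_ne_top hs.le hA.le hγ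
  refine ⟨(∑' k : ℕ, ENNReal.ofReal ((k + 1) * A) ^ s * (γ : ℝ≥0∞) ^ k).toNNReal,
    fun b hb N hN a hosc x₀ R hR => ?_⟩
  rw [ENNReal.coe_toNNReal hS]
  set c := a x₀ R
  have hNr : (0 : ℝ) < N := by exact_mod_cast hN
  have hdecay : ∀ k : ℕ, σ (levelSet b x₀ R c (k * (A * N))) ≤ γ ^ k * σ (ball x₀ R) := by
    intro k
    induction k with
    | zero => rw [pow_zero, one_mul]; exact measure_mono inter_subset_left
    | succ k ih =>
      have ht : 4 * 4 ^ n * (N : ℝ) ≤ (k + 1 : ℕ) * (A * N) := by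
        have h4 : (0 : ℝ) ≤ 4 * 4 ^ n * N := by positivity
        have hk : (0 : ℝ) ≤ k * (A * N) := by positivity
        have : A * N = 2 * (4 * 4 ^ n * (N : ℝ)) := by ring
        push_cast
        linarith
      have h := hK.measure_levelSet_le hσ hb hN hosc (x₀ := x₀) hR ht
      have h1 : ((k + 1 : ℕ) : ℝ) * (A * N) - 2 * (4 * 4 ^ n * N) = k * (A * N) := by
        push_cast; ring
      rw [h1] at h
      have h2 : σ (levelSet b x₀ R c ((k + 1 : ℕ) * (A * N))) ≤
          γ * σ (levelSet b x₀ R c (k * (A * N))) := by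
        have : ((γ : ℝ≥0) : ℝ≥0∞) = K / (1 + K) := by
          rw [hγdef, ENNReal.coe_div (by positivity)]; simp
        rw [this, ENNReal.mul_comm_div, ← mul_div_assoc,
          ENNReal.le_div_iff_mul_le (by simp) (by simp), mul_comm]
        exact h
      refine h2.trans ?_
      rw [pow_succ', mul_assoc (γ : ℝ≥0∞)]
      exact mul_le_mul_right ih _
  have hpt : ∀ y ∈ ball x₀ R, ENNReal.ofReal |b y - c| ^ s ≤
      ∑' k : ℕ, (levelSet b x₀ R c (k * (A * N))).indicator
        (fun _ => ENNReal.ofReal ((k + 1) * (A * N)) ^ s) y := by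
    intro y hy
    have hpos : 0 < A * N := by positivity
    set k := ⌊|b y - c| / (A * N)⌋₊
    refine le_trans ?_ (ENNReal.le_tsum k)
    have hk1 : k * (A * N) ≤ |b y - c| := by
      rw [← le_div_iff₀ hpos]; exact Nat.floor_le (by positivity)
    have hk2 : |b y - c| ≤ (k + 1) * (A * N) := by
      rw [← div_le_iff₀ hpos]; exact (Nat.lt_floor_add_one _).le
    rw [indicator_of_mem (show y ∈ levelSet b x₀ R c (k * (A * N)) from ⟨hy, hk1⟩)]
    gcongr
  have hmeas := fun k : ℕ => measurableSet_levelSet hb x₀ R c (k * (A * N))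
  calc ∫⁻ y in ball x₀ R, ENNReal.ofReal |b y - c| ^ s ∂σ
      ≤ ∫⁻ y in ball x₀ R, ∑' k : ℕ, (levelSet b x₀ R c (k * (A * N))).indicator
        (fun _ => ENNReal.ofReal ((k + 1) * (A * N)) ^ s) y ∂σ :=
        setLIntegral_mono' measurableSet_ball hpt
    _ ≤ ∫⁻ y, ∑' k : ℕ, (levelSet b x₀ R c (k * (A * N))).indicator
        (fun _ => ENNReal.ofReal ((k + 1) * (A * N)) ^ s) y ∂σ := setLIntegral_le_lintegral _ _
    _ = ∑' k : ℕ, ENNReal.ofReal ((k + 1) * (A * N)) ^ s *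
        σ (levelSet b x₀ R c (k * (A * N))) := by
      rw [lintegral_tsum fun k => (measurable_const.indicator (hmeas k)).aemeasurable]
      simp_rw [lintegral_indicator_const (hmeas _)]
    _ ≤ ∑' k : ℕ, (ENNReal.ofReal ((k + 1) * A) ^ s * (γ : ℝ≥0∞) ^ k) *
        ((N : ℝ≥0∞) ^ s * σ (ball x₀ R)) := by
      refine ENNReal.tsum_le_tsum fun k => ?_
      rw [← mul_assoc ((k : ℝ) + 1), ENNReal.ofReal_mul (by positivity),
        ENNReal.mul_rpow_of_nonneg _ _ hs.le, ENNReal.ofReal_coe_nnreal]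
      calc _ ≤ ENNReal.ofReal ((k + 1) * A) ^ s * (N : ℝ≥0∞) ^ s * (γ ^ k * σ (ball x₀ R)) := by
            gcongr; exact hdecay k
        _ = _ := by ring
    _ = _ := by rw [ENNReal.tsum_mul_right, mul_assoc]

/-- The measure `w^{-p'} dx` attached to a weight `w`. -/
def dualMeasure (p : ℝ) (w : Rn n → ℝ) : Measure (Rn n) :=
  volume.withDensity fun y => ENNReal.ofReal (w y) ^ (-(p / (p - 1)))

lemma aemeasurable_ofReal_rpow {w : Rn n → ℝ} (hw : IsWeight w) (s : ℝ) :
    AEMeasurable (fun y => ENNReal.ofReal (w y) ^ s) :=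
  hw.2.aestronglyMeasurable.aemeasurable.ennreal_ofReal.pow_const s

lemma IsApq.isBallControlled {p q : ℝ} {w : Rn n → ℝ} (hp : 1 < p) (hq : 0 < q) (hw : IsWeight w)
    (hApq : IsApq p q w) (hpos : ∀ᵐ x, 0 < w x) :
    ∃ K, IsBallControlled (dualMeasure p w) K := by
  obtain ⟨A, hA⟩ := hApq
  set s := p / (p - 1) with hs_def
  have hp1 : 0 < p - 1 := by linarith
  have hs : 0 < s := by positivity
  have hs1 : 1 - 1 / p = 1 / s := by rw [hs_def]; field_simp
  set θ := s / (s + q) with hθ_def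
  set η := q / (s + q) with hη_def
  have hθ : 0 < θ := by positivity
  have hη : 0 < η := by positivity
  have hθη : θ + η = 1 := by rw [hθ_def, hη_def]; field_simp
  set e := q * s / (s + q)
  have he : 0 < e := by positivity
  set A' : ℝ≥0 := A ^ e
  set K' : ℝ≥0 := 2 * 2 ^ n * A' * 6 ^ n
  refine ⟨K' ^ η⁻¹, fun x r hr G hG hGm hvol => ?_⟩
  set B := ball x (6 * r)
  set v := volume B
  set u := volume (ball x r)
  have hu0 : u ≠ 0 := (measure_ball_pos volume x hr).ne'
  have huT : u ≠ ∞ := measure_ball_lt_top.ne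
  have hv0 : v ≠ 0 := (measure_ball_pos volume x (by positivity)).ne'
  have hvT : v ≠ ∞ := measure_ball_lt_top.ne
  have hvu : v = 6 ^ n * u := by
    simp only [v, B, u]
    rw [volume_ball_mul x (by norm_num), ENNReal.ofReal_pow (by norm_num)]; simp
  set W := ∫⁻ y in B, ENNReal.ofReal (w y) ^ q
  have hSB : dualMeasure p w B = ∫⁻ y in B, ENNReal.ofReal (w y) ^ (-s) :=
    withDensity_apply _ measurableSet_ball
  set S := dualMeasure p w B
  have hA1 : W ^ θ * S ^ η ≤ A' * v := by
    have h := hA x (6 * r) (by positivity)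
    rw [hs1, ← hSB] at h
    have h' := ENNReal.rpow_le_rpow h he.le
    have e1 : 1 / q * e = θ := by simp only [e, hθ_def]; field_simp
    have e2 : 1 / s * e = η := by simp only [e, hη_def]; field_simp
    rw [ENNReal.mul_rpow_of_nonneg _ _ he.le, ← ENNReal.rpow_mul, ← ENNReal.rpow_mul, e1, e2,
      ENNReal.mul_rpow_of_nonneg _ _ hθ.le, ENNReal.mul_rpow_of_nonneg _ _ hη.le,
      ← ENNReal.coe_rpow_of_nonneg _ he.le, mul_mul_mul_comm,
      ← ENNReal.rpow_add_of_nonneg _ _ hθ.le hη.le, hθη, ENNReal.rpow_one,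
      ← ENNReal.div_eq_inv_mul, ENNReal.div_le_iff hv0 hvT] at h'
    exact h'
  have hHolder : volume G ≤ W ^ θ * dualMeasure p w G ^ η := by
    have hGS : dualMeasure p w G = ∫⁻ y in G, ENNReal.ofReal (w y) ^ (-s) :=
      withDensity_apply _ hGm
    have hWG : ∫⁻ y in G, ENNReal.ofReal (w y) ^ q ≤ W :=
      lintegral_mono_set (hG.trans (ball_subset_ball (by linarith)))
    calc volume G = ∫⁻ y in G, 1 := by simp
      _ = ∫⁻ y in G, (ENNReal.ofReal (w y) ^ q) ^ θ * (ENNReal.ofReal (w y) ^ (-s)) ^ η := by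
        refine lintegral_congr_ae (ae_restrict_of_ae ?_)
        filter_upwards [hpos] with y hy
        rw [← ENNReal.rpow_mul, ← ENNReal.rpow_mul, ← ENNReal.rpow_add _ _
          (by simpa using hy) ENNReal.ofReal_ne_top]
        have : q * θ + -s * η = 0 := by rw [hθ_def, hη_def]; ring
        rw [this, ENNReal.rpow_zero]
      _ ≤ (∫⁻ y in G, ENNReal.ofReal (w y) ^ q) ^ θ *
          (∫⁻ y in G, ENNReal.ofReal (w y) ^ (-s)) ^ η :=
        ENNReal.lintegral_mul_norm_pow_le (aemeasurable_ofReal_rpow hw q).restrict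
          (aemeasurable_ofReal_rpow hw (-s)).restrict hθ.le hη.le hθη
      _ ≤ _ := by rw [hGS]; gcongr
  have hmain : S ^ η ≤ K' * dualMeasure p w G ^ η := by
    refine (ENNReal.mul_le_mul_iff_right hu0 huT).1 ?_
    calc u * S ^ η ≤ 2 * 2 ^ n * (W ^ θ * dualMeasure p w G ^ η) * S ^ η := by
          gcongr; exact hvol.trans (by gcongr)
      _ = 2 * 2 ^ n * (W ^ θ * S ^ η) * dualMeasure p w G ^ η := by ring
      _ ≤ 2 * 2 ^ n * (A' * v) * dualMeasure p w G ^ η := by gcongr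
      _ = _ := by simp only [K', hvu]; push_cast; ring
  have h := ENNReal.rpow_le_rpow hmain (inv_nonneg.2 hη.le)
  rwa [ENNReal.rpow_rpow_inv hη.ne', ENNReal.mul_rpow_of_nonneg _ _ (inv_nonneg.2 hη.le),
    ENNReal.rpow_rpow_inv hη.ne', ← ENNReal.coe_rpow_of_nonneg _ (inv_nonneg.2 hη.le)] at h

/-- A weight in `A_{p,q}` that does not vanish identically is positive almost everywhere. -/
lemma IsApq.ae_pos {p q : ℝ} {w : Rn n → ℝ} (hp : 1 < p) (hq : 0 < q) (hw : IsWeight w)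
    (hApq : IsApq p q w) {x₀ : Rn n} {R : ℝ} (hR : 0 < R)
    (h0 : ∫⁻ y in ball x₀ R, ENNReal.ofReal (w y) ^ q ≠ 0) : ∀ᵐ x, 0 < w x := by
  obtain ⟨A, hA⟩ := hApq
  have hs : 0 < p / (p - 1) := div_pos (by linarith) (by linarith)
  have hp2 : 0 < 1 - 1 / p := by
    rw [sub_pos, div_lt_one (by linarith)]; exact hp
  have hball : ∀ k : ℕ, ∀ᵐ x, x ∈ ball x₀ (R + k) → 0 < w x := by
    intro k
    have hRk : 0 < R + k := by positivity
    set B := ball x₀ (R + k)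
    have hW : ∫⁻ y in B, ENNReal.ofReal (w y) ^ q ≠ 0 := fun h =>
      h0 (le_antisymm (h ▸ lintegral_mono_set (ball_subset_ball (by simp))) zero_le)
    have hvi : (volume B)⁻¹ ≠ 0 := ENNReal.inv_ne_zero.2 measure_ball_lt_top.ne
    have hS : ∫⁻ y in B, ENNReal.ofReal (w y) ^ (-(p / (p - 1))) ≠ ∞ := by
      intro hS
      have h := hA x₀ (R + k) hRk
      rw [hS, ENNReal.mul_top hvi, ENNReal.top_rpow_of_pos hp2, ENNReal.mul_top] at h
      · exact ENNReal.coe_ne_top (top_le_iff.1 h)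
      · exact (ENNReal.rpow_pos_of_nonneg (pos_iff_ne_zero.2 (mul_ne_zero hvi hW))
          (by positivity)).ne'
    have hlt := ae_lt_top' (aemeasurable_ofReal_rpow hw _).restrict hS
    rw [ae_restrict_iff' measurableSet_ball] at hlt
    filter_upwards [hlt] with x hx hxB
    by_contra hcon
    have := hx hxB
    rw [ENNReal.ofReal_of_nonpos (not_lt.1 hcon), ENNReal.zero_rpow_of_neg (by linarith)] at this
    exact lt_irrefl _ this
  filter_upwards [ae_all_iff.2 hball] with x hx
  obtain ⟨k, hk⟩ := exists_nat_gt (dist x x₀ - R)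
  exact hx k (by rw [mem_ball]; linarith)

lemma IsBMO.lintegral_deviation_le {b : Rn n → ℝ} (hb : IsBMO b) (x : Rn n) {r : ℝ} (hr : 0 < r) :
    ∫⁻ y in ball x r, ENNReal.ofReal |b y - avg b (ball x r)| ≤
      (bmoNorm b).toNNReal * volume (ball x r) := by
  rw [ENNReal.coe_toNNReal hb.2, ← ENNReal.div_le_iff (measure_ball_pos volume x hr).ne'
    measure_ball_lt_top.ne, ENNReal.div_eq_inv_mul]
  exact le_iSup_of_le x (le_iSup_of_le r (le_iSup_of_le hr le_rfl))

lemma IsApq.lintegral_deviation_rpow_le {p q : ℝ} {w b : Rn n → ℝ} (hp : 1 < p) (hq : 0 < q)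
    (hw : IsWeight w) (hApq : IsApq p q w) (hpos : ∀ᵐ x, 0 < w x) (hb : IsBMO b)
    (hb0 : bmoNorm b ≠ 0) :
    ∃ C : ℝ≥0, ∀ (x : Rn n) (r : ℝ), 0 < r →
      ∫⁻ y in ball x r, ENNReal.ofReal |b y - avg b (ball x r)| ^ (p / (p - 1)) *
          ENNReal.ofReal (w y) ^ (-(p / (p - 1))) ≤
        C * bmoNorm b ^ (p / (p - 1)) *
          ∫⁻ y in ball x r, ENNReal.ofReal (w y) ^ (-(p / (p - 1))) := by
  have hs : 0 < p / (p - 1) := div_pos (by linarith) (by linarith)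
  have hσ : dualMeasure p w ≪ volume := withDensity_absolutelyContinuous _ _
  obtain ⟨K, hK⟩ := hApq.isBallControlled hp hq hw hpos
  obtain ⟨C, hC⟩ := hK.lintegral_deviation_rpow_le hσ hs
  refine ⟨C, fun x r hr => ?_⟩
  have hbm : AEMeasurable b := hb.1.aestronglyMeasurable.aemeasurable
  have hbb := hbm.ae_eq_mk
  have h := hC (hbm.mk b) hbm.measurable_mk (bmoNorm b).toNNReal
    (ENNReal.toNNReal_pos hb0 hb.2) (fun x r => avg b (ball x r)) (fun x r hr => by
      refine le_of_eq_of_le (lintegral_congr_ae (ae_restrict_of_ae ?_))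
        (hb.lintegral_deviation_le x hr)
      filter_upwards [hbb] with y hy
      rw [hy]) x r hr
  rw [ENNReal.coe_toNNReal hb.2, dualMeasure, withDensity_apply _ measurableSet_ball,
    setLIntegral_withDensity_eq_lintegral_mul₀ (aemeasurable_ofReal_rpow hw _) (by
      have := hbm.measurable_mk
      fun_prop) measurableSet_ball] at h
  refine le_of_eq_of_le (lintegral_congr_ae (ae_restrict_of_ae ?_)) h
  filter_upwards [hbb] with y hy
  rw [Pi.mul_apply, mul_comm, hy]

/-- the estimate (3.8): for `w ∈ A_{p,q}` and `b ∈ BMO`,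
`(∫_B |b - b_B|^{p'} w^{-p'})^{1/p'} ≤ C ‖b‖_* |B|^{1/q+1/p'} w^q(B)^{-1/q}`. -/
theorem stmt11 (n : ℕ) (p q : ℝ) (w b : Rn n → ℝ)
    (hp : 1 < p) (hpq : p < q) (hw : IsWeight w) (hApq : IsApq p q w)
    (hb : IsBMO b) :
    ∃ C : ℝ≥0, ∀ (x : Rn n) (r : ℝ), 0 < r →
      (∫⁻ y in ball x r,
          ENNReal.ofReal |b y - avg b (ball x r)| ^ (p / (p - 1)) *
            ENNReal.ofReal (w y) ^ (-(p / (p - 1)))) ^ (1 - 1 / p) ≤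
        (C : ℝ≥0∞) * bmoNorm b * (volume (ball x r)) ^ (1 / q + (1 - 1 / p)) *
          (wMeas (fun z => w z ^ q) (ball x r)) ^ (-(1 / q)) := by
  have hq : 0 < q := by linarith
  have hp1 : 0 < p - 1 := by linarith
  set s := p / (p - 1) with hs_def
  have hs : 0 < s := by positivity
  have hs1 : 1 - 1 / p = 1 / s := by rw [hs_def]; field_simp
  rw [hs1]
  have hwq : ∀ E, wMeas (fun z => w z ^ q) E = ∫⁻ y in E, ENNReal.ofReal (w y) ^ q := fun E =>
    lintegral_congr fun y => (ENNReal.ofReal_rpow_of_nonneg (hw.1 y) hq.le).symm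
  simp_rw [hwq]
  by_cases hb0 : bmoNorm b = 0
  · refine ⟨0, fun x r hr => ?_⟩
    have h := hb.lintegral_deviation_le x hr
    rw [hb0, ENNReal.toNNReal_zero, ENNReal.coe_zero, zero_mul, nonpos_iff_eq_zero,
      lintegral_eq_zero_iff' (((hb.1.aestronglyMeasurable.aemeasurable.sub_const _).abs
      ).ennreal_ofReal.restrict)] at h
    have : ∫⁻ y in ball x r, ENNReal.ofReal |b y - avg b (ball x r)| ^ s *
        ENNReal.ofReal (w y) ^ (-s) = 0 := by
      rw [← lintegral_zero (μ := volume.restrict (ball x r))]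
      refine lintegral_congr_ae ?_
      filter_upwards [h] with y hy
      rw [hy, Pi.zero_apply, ENNReal.zero_rpow_of_pos hs, zero_mul]
    rw [this, ENNReal.zero_rpow_of_pos (by positivity)]
    exact zero_le
  have hvpow : ∀ (x : Rn n) (r : ℝ), 0 < r → volume (ball x r) ^ (1 / q + 1 / s) ≠ 0 :=
    fun x r hr => (ENNReal.rpow_pos (measure_ball_pos volume x hr) measure_ball_lt_top.ne).ne'
  by_cases hpos : ∀ᵐ x, 0 < w x
  swap
  · refine ⟨1, fun x r hr => ?_⟩
    have : ∫⁻ y in ball x r, ENNReal.ofReal (w y) ^ q = 0 := by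
      by_contra hcon
      exact hpos (hApq.ae_pos hp hq hw hr hcon)
    rw [this, ENNReal.zero_rpow_of_neg (by simpa using hq), ENNReal.mul_top]
    · exact le_top
    · simpa [hb0] using hvpow x r hr
  obtain ⟨C, hC⟩ := hApq.lintegral_deviation_rpow_le hp hq hw hpos hb hb0
  obtain ⟨A, hA⟩ := hApq
  refine ⟨C ^ (1 / s) * A, fun x r hr => ?_⟩
  have hA := hA x r hr
  rw [hs1] at hA
  have hv0 : volume (ball x r) ≠ 0 := (measure_ball_pos volume x hr).ne'
  have hvT : volume (ball x r) ≠ ∞ := measure_ball_lt_top.ne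
  have hW0 : ∫⁻ y in ball x r, ENNReal.ofReal (w y) ^ q ≠ 0 := by
    rw [Ne, lintegral_eq_zero_iff' (aemeasurable_ofReal_rpow hw q).restrict]
    intro h
    have hfalse : ∀ᵐ y ∂volume.restrict (ball x r), False := by
      filter_upwards [h, ae_restrict_of_ae hpos] with y hy hy0
      exact (ENNReal.rpow_pos (ENNReal.ofReal_pos.2 hy0) ENNReal.ofReal_ne_top).ne' hy
    rw [Filter.eventually_false_iff_eq_bot, ae_eq_bot, Measure.restrict_eq_zero] at hfalse
    exact hv0 hfalse
  have hC := ENNReal.rpow_le_rpow (hC x r hr) (one_div_nonneg.2 hs.le)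
  refine hC.trans ?_
  rw [ENNReal.mul_rpow_of_nonneg _ _ (by positivity), ENNReal.mul_rpow_of_nonneg _ _ (by positivity),
    ← ENNReal.rpow_mul, mul_one_div_cancel hs.ne', ENNReal.rpow_one, ENNReal.coe_mul,
    ENNReal.coe_rpow_of_nonneg _ (by positivity)]
  set v := volume (ball x r)
  set W := ∫⁻ y in ball x r, ENNReal.ofReal (w y) ^ q
  set S := ∫⁻ y in ball x r, ENNReal.ofReal (w y) ^ (-s)
  have hSW : S ^ (1 / s) ≤ A * v ^ (1 / q + 1 / s) * W ^ (-(1 / q)) := by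
    rw [ENNReal.rpow_neg, ← div_eq_mul_inv, ENNReal.le_div_iff_mul_le
      (Or.inl fun h => hW0 ((ENNReal.rpow_eq_zero_iff_of_pos (by positivity)).1 h))
      (Or.inr (ENNReal.mul_ne_top ENNReal.coe_ne_top (ENNReal.rpow_ne_top_of_nonneg (by positivity) hvT))), ← ENNReal.div_le_iff
        (hvpow x r hr) (ENNReal.rpow_ne_top_of_nonneg (by positivity) hvT)]
    refine le_of_eq_of_le ?_ hA
    rw [ENNReal.mul_rpow_of_nonneg _ _ (by positivity),
      ENNReal.mul_rpow_of_nonneg _ _ (by positivity), mul_mul_mul_comm,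
      ← ENNReal.rpow_add_of_nonneg _ _ (by positivity) (by positivity), ENNReal.inv_rpow,
      ENNReal.div_eq_inv_mul, mul_comm (S ^ _)]
  calc _ ≤ C ^ (1 / s) * bmoNorm b * (A * v ^ (1 / q + 1 / s) * W ^ (-(1 / q))) := by gcongr
    _ = _ := by ring
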